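/- Let r > 2 and δ > 0 be real numbers. If G is a finite simple graph and S ⊆ V(G) satisfies (r−2)·e(G[S]) > (r−1)·δ·|S| + e(G(S, V(G)∖S)), then there exists a non-empty subset S' ⊆ S such that (i) every vertex of G[S'] has degree at least δ in G[S'], and (ii) every v ∈ S' satisfies |N_G(v) ∩ S'| ≥ deg_G(v)/r. -/

import Mathlib

open SimpleGraph

/-- Number of edges of the subgraph of `G` induced on `S`. -/
noncomputable def edgesOn {V : Type*} (G : SimpleGraph V) (S : Set V) : ℕ :=
  ((G.induce S).edgeSet).ncard

/-- Number of edges of `G` with one end in `S` and the other in `T`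
(for disjoint `S`, `T`). -/
noncomputable def edgesBetween {V : Type*} (G : SimpleGraph V) (S T : Set V) : ℕ :=
  {p : V × V | p.1 ∈ S ∧ p.2 ∈ T ∧ G.Adj p.1 p.2}.ncard

open Classical in
theorem aux_edgesOn {V : Type*} [Fintype V] (G : SimpleGraph V) (S : Finset V) :
    2 * (edgesOn G (S : Set V) : ℝ) =
      ∑ u ∈ S, ((S.filter (fun w => G.Adj u w)).card : ℝ) := by
  have h1 := (G.induce (S : Set V)).sum_degrees_eq_twice_card_edges
  have h2 : edgesOn G (S : Set V) = (G.induce (S : Set V)).edgeFinset.card := by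
    unfold edgesOn
    rw [← SimpleGraph.coe_edgeFinset, Set.ncard_coe_finset]
  have h3 : ∀ v : (S : Set V), (G.induce (S : Set V)).degree v =
      (S.filter (fun w => G.Adj v w)).card := by
    intro v
    rw [← SimpleGraph.card_neighborFinset_eq_degree,
      ← Finset.card_map (Function.Embedding.subtype _)]
    congr 1
    ext w
    simp [and_comm]
  rw [h2]
  have h4 : ∑ u ∈ S, (S.filter (fun w => G.Adj u w)).card =
      2 * (G.induce (S : Set V)).edgeFinset.card := by
    rw [← h1, ← Finset.sum_coe_sort S]
    refine (Finset.sum_congr rfl fun v _ => (h3 v)).symm.trans ?_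
    rfl
  exact_mod_cast h4.symm

open Classical in
theorem aux_between {V : Type*} [Fintype V] (G : SimpleGraph V) (S T : Finset V) :
    (edgesBetween G (S : Set V) (T : Set V) : ℝ) =
      ∑ u ∈ S, ((T.filter (fun w => G.Adj u w)).card : ℝ) := by
  have : edgesBetween G (S : Set V) (T : Set V) =
      ∑ u ∈ S, (T.filter (fun w => G.Adj u w)).card := by
    unfold edgesBetween
    rw [← Finset.card_sigma, ← Finset.card_map (Equiv.sigmaEquivProd V V).toEmbedding,
      ← Set.ncard_coe_finset]
    congr 1
    ext ⟨a, b⟩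
    simp
  exact_mod_cast this

theorem aux_main {V : Type*} [Fintype V] [DecidableEq V] (G : SimpleGraph V)
    [DecidableRel G.Adj] (r δ : ℝ) (hr : 2 < r) (hδ : 0 < δ) (S : Finset V)
    (h : 0 < r / 2 * ∑ u ∈ S, ((S.filter (fun w => G.Adj u w)).card : ℝ)
      - (r - 1) * δ * S.card - ∑ u ∈ S, (G.degree u : ℝ)) :
    ∃ S' : Finset V, S' ⊆ S ∧ S'.Nonempty ∧
      (∀ v ∈ S', δ ≤ ((S'.filter (fun u => G.Adj v u)).card : ℝ)) ∧
      (∀ v ∈ S', (G.degree v : ℝ) / r ≤ ((S'.filter (fun u => G.Adj v u)).card : ℝ)) := by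
  induction S using Finset.strongInduction with
  | H S ih =>
  by_cases hb : ∃ v ∈ S, ((S.filter (fun u => G.Adj v u)).card : ℝ) < δ ∨
      ((S.filter (fun u => G.Adj v u)).card : ℝ) < (G.degree v : ℝ) / r
  · obtain ⟨v, hv, hbad⟩ := hb
    have hss := Finset.erase_ssubset hv
    obtain ⟨S', h1, h2⟩ := ih (S.erase v) hss (by
      have hvT : v ∉ S.erase v := by simp
      have hST : S = insert v (S.erase v) := (Finset.insert_erase hv).symm
      generalize S.erase v = T at hvT hST
      subst hST
      have hd : (((insert v T).filter (fun u => G.Adj v u)).card : ℝ)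
          = ((T.filter (fun u => G.Adj v u)).card : ℝ) := by
        rw [Finset.filter_insert]; simp
      have hs : ∑ u ∈ T, (((insert v T).filter (fun w => G.Adj u w)).card : ℝ)
          = ∑ u ∈ T, ((T.filter (fun w => G.Adj u w)).card : ℝ)
            + ((T.filter (fun u => G.Adj v u)).card : ℝ) := by
        rw [Finset.card_filter (fun u => G.Adj v u) T]
        push_cast
        rw [← Finset.sum_add_distrib]
        refine Finset.sum_congr rfl fun u _ => ?_
        rw [Finset.filter_insert]
        by_cases huv : G.Adj u v
        · rw [if_pos huv, if_pos huv.symm, Finset.card_insert_of_notMem (by simp [hvT])]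
          push_cast; rfl
        · rw [if_neg huv, if_neg (fun h => huv h.symm)]; simp
      have hle : ((T.filter (fun u => G.Adj v u)).card : ℝ) ≤ (G.degree v : ℝ) := by
        rw [← SimpleGraph.card_neighborFinset_eq_degree]
        exact_mod_cast Finset.card_le_card (fun w hw => by simpa using (Finset.mem_filter.1 hw).2)
      rw [Finset.sum_insert hvT, Finset.sum_insert hvT, hs, hd,
        Finset.card_insert_of_notMem hvT] at h
      rw [hd] at hbad
      push_cast at h
      rcases hbad with hb | hb
      · nlinarith
      · rw [lt_div_iff₀ (by linarith)] at hb
        have hp : 0 < (r - 1) * δ := mul_pos (by linarith) hδ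
        nlinarith)
    exact ⟨S', h1.trans hss.subset, h2⟩
  · push Not at hb
    refine ⟨S, subset_rfl, ?_, fun v hv => (hb v hv).1, fun v hv => (hb v hv).2⟩
    rw [Finset.nonempty_iff_ne_empty]
    rintro rfl
    simp at h

/-- if `(r-2)·e(G[S]) > (r-1)·δ·|S| + e(G(S, V∖S))` then there is a
non-empty `S' ⊆ S` such that `G[S']` has minimum degree at least `δ` and every
`v ∈ S'` has at least `deg_G(v)/r` neighbours in `S'`. -/
theorem stmt_1 {V : Type*} [Fintype V] [DecidableEq V] (G : SimpleGraph V)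
    [DecidableRel G.Adj] (r δ : ℝ) (hr : 2 < r) (hδ : 0 < δ) (S : Finset V)
    (h : (r - 2) * (edgesOn G (S : Set V) : ℝ) >
      (r - 1) * δ * S.card + (edgesBetween G (S : Set V) ((Sᶜ : Finset V) : Set V) : ℝ)) :
    ∃ S' : Finset V, S' ⊆ S ∧ S'.Nonempty ∧
      (∀ v ∈ S', δ ≤ ((S'.filter (fun u => G.Adj v u)).card : ℝ)) ∧
      (∀ v ∈ S', (G.degree v : ℝ) / r ≤ ((S'.filter (fun u => G.Adj v u)).card : ℝ)) := by
  apply aux_main G r δ hr hδ S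
  have h1 := aux_edgesOn G S
  have h2 := aux_between G S Sᶜ
  have h3 : ∑ u ∈ S, (G.degree u : ℝ) = ∑ u ∈ S, ((S.filter (fun w => G.Adj u w)).card : ℝ)
      + ∑ u ∈ S, ((Sᶜ.filter (fun w => G.Adj u w)).card : ℝ) := by
    rw [← Finset.sum_add_distrib]
    refine Finset.sum_congr rfl fun u _ => ?_
    rw [← SimpleGraph.card_neighborFinset_eq_degree]
    norm_cast
    rw [← Finset.card_union_of_disjoint, ← Finset.filter_union, Finset.union_compl]
    · congr 1; ext; simp
    · exact Finset.disjoint_filter_filter disjoint_compl_right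
  have h1' : 2 * (edgesOn G (S : Set V) : ℝ) =
      ∑ u ∈ S, ((S.filter (fun w => G.Adj u w)).card : ℝ) := by
    convert h1
  have h2' : (edgesBetween G (S : Set V) ((Sᶜ : Finset V) : Set V) : ℝ) =
      ∑ u ∈ S, ((Sᶜ.filter (fun w => G.Adj u w)).card : ℝ) := by
    convert h2
  rw [h3, ← h1', ← h2']
  nlinarith
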